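/- arXiv:1402.4232 — 3 statements merged into one kernel-verified Lean document; each statement's English description precedes it below -/
import Mathlib

section
/- Let n ≥ 1, T > 0, and let γ, α, β, a, b, c, d, λ be real constants with α ≠ 0 and α ≠ β. Let S, u : (0,T) × ℝⁿ → ℝ be smooth with ∂_τ u = Δu − |∇u|² − c·S − γ·u on (0,T) × ℝⁿ, and define H := α·Δu − β·|∇u|² + a·S + b·u/τ + d·n/τ. Then on (0,T) × ℝⁿ: ∂_τ H = ΔH − 2·⟨∇H, ∇u⟩ − 2(α−β)·‖∇²u − (λ/(2τ))·Id‖² + 2(a+βc)·⟨∇S, ∇u⟩ − (2(α−β)λ/(ατ))·H + (α−β)·n·λ²/(2τ²) + (b − 2(α−β)λβ/α)·|∇u|²/τ + (2(α−β)aλ/α − bc)·S/τ + (2(α−β)λ/α − 1)·(b/τ²)·u + (2(α−β)λ/α − 1)·(d/τ²)·n − αγ·Δu + 2βγ·|∇u|² − bγ·u/τ + a·∂_τ S − (a+αc)·ΔS, where ‖∇²u − (λ/(2τ))·Id‖² := ∑_{i,j} (∂ᵢ∂ⱼu − δᵢⱼ·λ/(2τ))². -/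
open Set
open scoped RealInnerProductSpace

noncomputable section

/-- The `i`-th standard basis vector of `ℝⁿ`. -/
def e (n : ℕ) (i : Fin n) : EuclideanSpace ℝ (Fin n) := EuclideanSpace.single i 1

/-- Spatial gradient of a time-dependent function on `ℝⁿ`. -/
def sgrad (n : ℕ) (u : ℝ → EuclideanSpace ℝ (Fin n) → ℝ) (t : ℝ)
    (x : EuclideanSpace ℝ (Fin n)) : EuclideanSpace ℝ (Fin n) :=
  gradient (u t) x

/-- `(i,j)` entry of the spatial Hessian of a time-dependent function on `ℝⁿ`. -/
def shess (n : ℕ) (u : ℝ → EuclideanSpace ℝ (Fin n) → ℝ) (t : ℝ)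
    (x : EuclideanSpace ℝ (Fin n)) (i j : Fin n) : ℝ :=
  fderiv ℝ (fun y => fderiv ℝ (u t) y (e n j)) x (e n i)

/-- Spatial Laplacian (trace of the spatial Hessian). -/
def slap (n : ℕ) (u : ℝ → EuclideanSpace ℝ (Fin n) → ℝ) (t : ℝ)
    (x : EuclideanSpace ℝ (Fin n)) : ℝ :=
  ∑ i, shess n u t x i i

/-- Squared Frobenius norm of the spatial Hessian. -/
def hessSq (n : ℕ) (u : ℝ → EuclideanSpace ℝ (Fin n) → ℝ) (t : ℝ)
    (x : EuclideanSpace ℝ (Fin n)) : ℝ :=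
  ∑ i, ∑ j, (shess n u t x i j) ^ 2

/-- Time derivative of a time-dependent function on `ℝⁿ`. -/
def tderiv (n : ℕ) (u : ℝ → EuclideanSpace ℝ (Fin n) → ℝ) (t : ℝ)
    (x : EuclideanSpace ℝ (Fin n)) : ℝ :=
  deriv (fun s => u s x) t

/-! ### Calculus of directional derivatives on space-time -/

/-- Space-time. -/
abbrev STime (n : ℕ) := ℝ × EuclideanSpace ℝ (Fin n)

/-- The open slab `(0,T) × ℝⁿ`. -/
def Om (n : ℕ) (T : ℝ) : Set (STime n) :=
  Ioo (0 : ℝ) T ×ˢ (univ : Set (EuclideanSpace ℝ (Fin n)))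

/-- Directional derivative on space-time. -/
def DD (n : ℕ) (v : STime n) (f : STime n → ℝ) (p : STime n) : ℝ := fderiv ℝ f p v

/-- Smooth on the slab. -/
def Sm (n : ℕ) (T : ℝ) (f : STime n → ℝ) : Prop := ContDiffOn ℝ (⊤ : ℕ∞) f (Om n T)

/-- Spatial directions. -/
def ex (n : ℕ) (i : Fin n) : STime n := (0, e n i)

/-- Time direction. -/
def et (n : ℕ) : STime n := (1, 0)

/-- Laplacian on space-time functions. -/
def LL (n : ℕ) (f : STime n → ℝ) (p : STime n) : ℝ := ∑ i, DD n (ex n i) (DD n (ex n i) f) p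

/-- Inner product of gradients. -/
def GG (n : ℕ) (f g : STime n → ℝ) (p : STime n) : ℝ :=
  ∑ i, DD n (ex n i) f p * DD n (ex n i) g p

section stcalc
variable {n : ℕ} {T : ℝ} {f g : STime n → ℝ} {p : STime n}

lemma isOpen_Om : IsOpen (Om n T) := isOpen_Ioo.prod isOpen_univ

lemma Om_nhds (hp : p ∈ Om n T) : Om n T ∈ nhds p := isOpen_Om.mem_nhds hp

lemma Sm.cda (hf : Sm n T f) (hp : p ∈ Om n T) : ContDiffAt ℝ (⊤ : ℕ∞) f p :=
  ContDiffOn.contDiffAt hf (Om_nhds hp)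

lemma Sm.da (hf : Sm n T f) (hp : p ∈ Om n T) : DifferentiableAt ℝ f p :=
  (hf.cda hp).differentiableAt (by simp)

lemma Sm.DD (hf : Sm n T f) (v : STime n) : Sm n T (DD n v f) := by
  have h : ContDiffOn ℝ (⊤ : ℕ∞) (fderiv ℝ f) (Om n T) :=
    ContDiffOn.fderiv_of_isOpen hf isOpen_Om (by simp)
  exact h.clm_apply contDiffOn_const

lemma Sm.add (hf : Sm n T f) (hg : Sm n T g) : Sm n T (fun p => f p + g p) :=
  ContDiffOn.add hf hg

lemma Sm.mul (hf : Sm n T f) (hg : Sm n T g) : Sm n T (fun p => f p * g p) :=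
  ContDiffOn.mul hf hg

lemma Sm.cmul (hf : Sm n T f) (c : ℝ) : Sm n T (fun p => c * f p) :=
  ContDiffOn.mul contDiffOn_const hf

lemma Sm.sum {F : Fin n → STime n → ℝ} (hf : ∀ i, Sm n T (F i)) :
    Sm n T (fun p => ∑ i, F i p) :=
  ContDiffOn.sum (fun i _ => hf i)

lemma Sm.LL (hf : Sm n T f) : Sm n T (LL n f) := Sm.sum fun i => (hf.DD _).DD _

lemma Sm.GG (hf : Sm n T f) (hg : Sm n T g) : Sm n T (GG n f g) :=
  Sm.sum fun i => (hf.DD _).mul (hg.DD _)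

lemma DD_congr (h : ∀ q ∈ Om n T, f q = g q) (v : STime n) (hp : p ∈ Om n T) :
    DD n v f p = DD n v g p := by
  have : f =ᶠ[nhds p] g := Filter.eventually_of_mem (Om_nhds hp) h
  simp only [DD, this.fderiv_eq]

lemma DD_add (hf : Sm n T f) (hg : Sm n T g) (v : STime n) (hp : p ∈ Om n T) :
    DD n v (fun p => f p + g p) p = DD n v f p + DD n v g p := by
  simp only [DD]
  rw [fderiv_fun_add (hf.da hp) (hg.da hp)]; rfl

lemma DD_mul (hf : Sm n T f) (hg : Sm n T g) (v : STime n) (hp : p ∈ Om n T) :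
    DD n v (fun p => f p * g p) p = DD n v f p * g p + f p * DD n v g p := by
  simp only [DD]
  rw [fderiv_fun_mul (hf.da hp) (hg.da hp)]
  simp; ring

lemma DD_cmul (hf : Sm n T f) (c : ℝ) (v : STime n) (hp : p ∈ Om n T) :
    DD n v (fun p => c * f p) p = c * DD n v f p := by
  simp only [DD]
  rw [fderiv_const_mul (hf.da hp)]; simp

lemma DD_sum {F : Fin n → STime n → ℝ} (hf : ∀ i, Sm n T (F i)) (v : STime n)
    (hp : p ∈ Om n T) : DD n v (fun p => ∑ i, F i p) p = ∑ i, DD n v (F i) p := by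
  simp only [DD]
  rw [fderiv_fun_sum (fun i _ => (hf i).da hp)]; simp

lemma DD_comm (hf : Sm n T f) (v w : STime n) (hp : p ∈ Om n T) :
    DD n v (DD n w f) p = DD n w (DD n v f) p := by
  have hs : IsSymmSndFDerivAt ℝ f p := (hf.cda hp).isSymmSndFDerivAt (by
    simp only [minSmoothness_of_isRCLikeNormedField]
    exact WithTop.coe_le_coe.2 (le_top : (2 : ℕ∞) ≤ ⊤))
  have hd : DifferentiableAt ℝ (fderiv ℝ f) p :=
    ((hf.cda hp).fderiv_right (m := 1) (by norm_cast)).differentiableAt (by simp)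
  have key : ∀ v w, DD n v (DD n w f) p = fderiv ℝ (fderiv ℝ f) p v w := by
    intro v w
    have : DD n w f = fun q => fderiv ℝ f q w := rfl
    rw [this]
    simp only [DD]
    rw [fderiv_clm_apply hd (differentiableAt_const _)]
    simp
  rw [key, key]
  exact hs v w

lemma LL_congr (h : ∀ q ∈ Om n T, f q = g q) (hp : p ∈ Om n T) : LL n f p = LL n g p :=
  Finset.sum_congr rfl fun _ _ => DD_congr (fun _ hq => DD_congr h _ hq) _ hp

lemma LL_add (hf : Sm n T f) (hg : Sm n T g) (hp : p ∈ Om n T) :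
    LL n (fun p => f p + g p) p = LL n f p + LL n g p := by
  simp only [LL, ← Finset.sum_add_distrib]
  refine Finset.sum_congr rfl fun i _ => ?_
  rw [DD_congr (fun q hq => DD_add hf hg _ hq) _ hp, DD_add (hf.DD _) (hg.DD _) _ hp]

lemma LL_cmul (hf : Sm n T f) (c : ℝ) (hp : p ∈ Om n T) :
    LL n (fun p => c * f p) p = c * LL n f p := by
  simp only [LL, Finset.mul_sum]
  refine Finset.sum_congr rfl fun i _ => ?_
  rw [DD_congr (fun q hq => DD_cmul hf c _ hq) _ hp, DD_cmul (hf.DD _) _ _ hp]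

lemma GG_congr {k : STime n → ℝ} (h : ∀ q ∈ Om n T, f q = g q) (hp : p ∈ Om n T) :
    GG n f k p = GG n g k p :=
  Finset.sum_congr rfl fun _ _ => by rw [DD_congr h _ hp]

lemma GG_add {k : STime n → ℝ} (hf : Sm n T f) (hg : Sm n T g) (hp : p ∈ Om n T) :
    GG n (fun p => f p + g p) k p = GG n f k p + GG n g k p := by
  simp only [GG, ← Finset.sum_add_distrib]
  refine Finset.sum_congr rfl fun i _ => ?_
  rw [DD_add hf hg _ hp]; ring

lemma GG_cmul {k : STime n → ℝ} (hf : Sm n T f) (c : ℝ) (hp : p ∈ Om n T) :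
    GG n (fun p => c * f p) k p = c * GG n f k p := by
  simp only [GG, Finset.mul_sum]
  refine Finset.sum_congr rfl fun i _ => ?_
  rw [DD_cmul hf _ _ hp]; ring

/-- commuting any derivative with the Laplacian -/
lemma DD_LL (hf : Sm n T f) (v : STime n) (hp : p ∈ Om n T) :
    DD n v (LL n f) p = LL n (DD n v f) p := by
  have : LL n f = fun p => ∑ i, DD n (ex n i) (DD n (ex n i) f) p := rfl
  rw [this, DD_sum (fun i => (hf.DD _).DD _) _ hp]
  refine Finset.sum_congr rfl fun i _ => ?_
  rw [DD_comm (hf.DD _) _ _ hp]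
  exact DD_congr (fun q hq => DD_comm hf _ _ hq) _ hp

lemma DD_GG (hf : Sm n T f) (v : STime n) (hp : p ∈ Om n T) :
    DD n v (GG n f f) p = 2 * GG n (DD n v f) f p := by
  have : GG n f f = fun p => ∑ i, DD n (ex n i) f p * DD n (ex n i) f p := rfl
  rw [this, DD_sum (fun i => (hf.DD _).mul (hf.DD _)) _ hp]
  simp only [GG, Finset.mul_sum]
  refine Finset.sum_congr rfl fun i _ => ?_
  rw [DD_mul (hf.DD _) (hf.DD _) _ hp, DD_comm hf v _ hp]; ring

/-- Bochner formula on flat space. -/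
lemma LL_GG (hf : Sm n T f) (hp : p ∈ Om n T) :
    LL n (GG n f f) p = 2 * (∑ i, ∑ j, (DD n (ex n i) (DD n (ex n j) f) p) ^ 2)
      + 2 * GG n (LL n f) f p := by
  have h1 : ∀ j, DD n (ex n j) (DD n (ex n j) (GG n f f)) p
      = 2 * ∑ i, ((DD n (ex n j) (DD n (ex n i) f) p) ^ 2
        + DD n (ex n j) (DD n (ex n j) (DD n (ex n i) f)) p * DD n (ex n i) f p) := by
    intro j
    rw [DD_congr (fun q hq => DD_GG hf _ hq) _ hp,
      DD_cmul ((hf.DD _).GG hf) _ _ hp]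
    congr 1
    have : GG n (DD n (ex n j) f) f
      = fun p => ∑ i, DD n (ex n i) (DD n (ex n j) f) p * DD n (ex n i) f p := rfl
    rw [this, DD_sum (fun i => ((hf.DD _).DD _).mul (hf.DD _)) _ hp]
    refine Finset.sum_congr rfl fun i _ => ?_
    rw [DD_mul ((hf.DD _).DD _) (hf.DD _) _ hp,
      DD_congr (fun q hq => DD_comm hf (ex n i) (ex n j) hq) _ hp, DD_comm hf (ex n i) _ hp]
    ring
  have h2 : GG n (LL n f) f p
      = ∑ j, ∑ i, DD n (ex n j) (DD n (ex n j) (DD n (ex n i) f)) p * DD n (ex n i) f p := by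
    rw [Finset.sum_comm]
    refine Finset.sum_congr rfl fun i _ => ?_
    rw [DD_LL hf _ hp, LL, Finset.sum_mul]
  rw [h2]
  rw [LL, Finset.sum_congr rfl fun j _ => h1 j]
  simp only [Finset.sum_add_distrib, ← Finset.mul_sum]
  ring

/-- inverse time -/
def rr (n : ℕ) (p : STime n) : ℝ := p.1⁻¹

lemma Sm_rr : Sm n T (rr n) := by
  have : ContDiffOn ℝ (⊤ : ℕ∞) (fun p : STime n => p.1) (Om n T) := contDiffOn_fst
  exact this.inv fun p hp => hp.1.1.ne'

lemma DD_rr (v : STime n) (hp : p ∈ Om n T) : DD n v (rr n) p = - v.1 * (rr n p) ^ 2 := by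
  have h0 : p.1 ≠ 0 := hp.1.1.ne'
  have h := (hasDerivAt_inv h0).comp_hasFDerivAt p (hasFDerivAt_fst (𝕜 := ℝ) (p := p))
  have h' : HasFDerivAt (rr n) _ p := h
  simp only [DD, h'.fderiv, rr]
  simp
  ring

lemma DD_ex_rr (i : Fin n) (hp : p ∈ Om n T) : DD n (ex n i) (rr n) p = 0 := by
  rw [DD_rr _ hp]; simp [ex]

lemma DD_et_rr (hp : p ∈ Om n T) : DD n (et n) (rr n) p = - (rr n p) ^ 2 := by
  rw [DD_rr _ hp]; simp [et]

lemma GG_mul_rr {k : STime n → ℝ} (hf : Sm n T f) (hp : p ∈ Om n T) :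
    GG n (fun p => f p * rr n p) k p = rr n p * GG n f k p := by
  simp only [GG, Finset.mul_sum]
  refine Finset.sum_congr rfl fun i _ => ?_
  rw [DD_mul hf Sm_rr _ hp, DD_ex_rr i hp]; ring

lemma LL_mul_rr (hf : Sm n T f) (hp : p ∈ Om n T) :
    LL n (fun p => f p * rr n p) p = rr n p * LL n f p := by
  simp only [LL, Finset.mul_sum]
  refine Finset.sum_congr rfl fun i _ => ?_
  have h : ∀ q ∈ Om n T, DD n (ex n i) (fun p => f p * rr n p) q
      = DD n (ex n i) f q * rr n q := fun q hq => by
    rw [DD_mul hf Sm_rr _ hq, DD_ex_rr i hq]; ring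
  rw [DD_congr h _ hp, DD_mul (hf.DD _) Sm_rr _ hp, DD_ex_rr i hp]; ring

lemma GG_rr {k : STime n → ℝ} (hp : p ∈ Om n T) : GG n (rr n) k p = 0 :=
  Finset.sum_eq_zero fun i _ => by rw [DD_ex_rr i hp, zero_mul]

lemma LL_rr (hp : p ∈ Om n T) : LL n (rr n) p = 0 :=
  Finset.sum_eq_zero fun i _ => by
    rw [DD_congr (g := fun _ => 0) (fun q hq => DD_ex_rr i hq) _ hp]; simp [DD]

/-! ### Translation of the frozen definitions -/

variable {w : ℝ → EuclideanSpace ℝ (Fin n) → ℝ} {t : ℝ} {x : EuclideanSpace ℝ (Fin n)}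

lemma mem_Om (ht : t ∈ Ioo (0 : ℝ) T) (x : EuclideanSpace ℝ (Fin n)) : (t, x) ∈ Om n T :=
  ⟨ht, mem_univ _⟩

lemma fderiv_slice (hf : Sm n T f) (ht : t ∈ Ioo (0 : ℝ) T) (x : EuclideanSpace ℝ (Fin n))
    (i : Fin n) : fderiv ℝ (fun y => f (t, y)) x (e n i) = DD n (ex n i) f (t, x) := by
  have h := (hf.da (mem_Om ht x)).hasFDerivAt.comp x (hasFDerivAt_prodMk_right t x)
  have h' : HasFDerivAt (fun y => f (t, y)) _ x := h
  rw [h'.fderiv]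
  simp [DD, ex]

lemma tderiv_eq (hw : Sm n T (Function.uncurry w)) (ht : t ∈ Ioo (0 : ℝ) T)
    (x : EuclideanSpace ℝ (Fin n)) :
    tderiv n w t x = DD n (et n) (Function.uncurry w) (t, x) := by
  have h := (hw.da (mem_Om ht x)).hasFDerivAt.comp t (hasFDerivAt_prodMk_left (𝕜 := ℝ) t x)
  have h' : HasFDerivAt (fun s => w s x) _ t := h
  rw [tderiv, ← fderiv_apply_one_eq_deriv, h'.fderiv]
  simp [DD, et]

lemma shess_eq (hw : Sm n T (Function.uncurry w)) (ht : t ∈ Ioo (0 : ℝ) T)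
    (x : EuclideanSpace ℝ (Fin n)) (i j : Fin n) :
    shess n w t x i j = DD n (ex n i) (DD n (ex n j) (Function.uncurry w)) (t, x) := by
  have : (fun y => fderiv ℝ (w t) y (e n j))
      = fun y => DD n (ex n j) (Function.uncurry w) (t, y) := by
    funext y
    exact fderiv_slice hw ht y j
  rw [shess, this, fderiv_slice (hw.DD _) ht]

lemma slap_eq (hw : Sm n T (Function.uncurry w)) (ht : t ∈ Ioo (0 : ℝ) T)
    (x : EuclideanSpace ℝ (Fin n)) : slap n w t x = LL n (Function.uncurry w) (t, x) :=
  Finset.sum_congr rfl fun i _ => shess_eq hw ht x i i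

lemma sgrad_apply (hw : Sm n T (Function.uncurry w)) (ht : t ∈ Ioo (0 : ℝ) T)
    (x : EuclideanSpace ℝ (Fin n)) (i : Fin n) :
    sgrad n w t x i = DD n (ex n i) (Function.uncurry w) (t, x) := by
  rw [← fderiv_slice hw ht x i]
  have h : ⟪gradient (w t) x, e n i⟫ = fderiv ℝ (w t) x (e n i) := by
    rw [gradient, InnerProductSpace.toDual_symm_apply]
  have h2 : ⟪gradient (w t) x, e n i⟫ = gradient (w t) x i := by
    rw [e, EuclideanSpace.inner_single_right]; simp
  rw [sgrad, ← h2, h]; rfl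

lemma inner_sgrad {z : ℝ → EuclideanSpace ℝ (Fin n) → ℝ} (hw : Sm n T (Function.uncurry w))
    (hz : Sm n T (Function.uncurry z)) (ht : t ∈ Ioo (0 : ℝ) T)
    (x : EuclideanSpace ℝ (Fin n)) : ⟪sgrad n w t x, sgrad n z t x⟫
      = GG n (Function.uncurry w) (Function.uncurry z) (t, x) := by
  rw [PiLp.inner_apply]
  refine Finset.sum_congr rfl fun i _ => ?_
  rw [sgrad_apply hw ht, sgrad_apply hz ht]
  simp [mul_comm]

lemma normsq_sgrad (hw : Sm n T (Function.uncurry w)) (ht : t ∈ Ioo (0 : ℝ) T)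
    (x : EuclideanSpace ℝ (Fin n)) : ‖sgrad n w t x‖ ^ 2
      = GG n (Function.uncurry w) (Function.uncurry w) (t, x) := by
  rw [← inner_sgrad hw hw ht, real_inner_self_eq_norm_sq]

lemma square_expand (A : Fin n → Fin n → ℝ) (m : ℝ) :
    ∑ i, ∑ j, (A i j - (if i = j then m else 0)) ^ 2
      = (∑ i, ∑ j, A i j ^ 2) - 2 * m * (∑ i, A i i) + n * m ^ 2 := by
  have : ∀ i j, (A i j - (if i = j then m else 0)) ^ 2
      = A i j ^ 2 - (if i = j then 2 * m * A i j - m ^ 2 else 0) := by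
    intro i j; split_ifs <;> ring
  simp only [this, Finset.sum_sub_distrib, Finset.sum_ite_eq, Finset.mem_univ, if_true,
    ← Finset.mul_sum]
  simp
  ring

end stcalc

/-- Theorem 3.3 (completed-square form of the evolution equation for `H`),
static flat case. -/
theorem evolution_harnack_quantity_completed_square (n : ℕ) (hn : 1 ≤ n)
    (T γ α β a b c d lam : ℝ) (hT : 0 < T) (hα : α ≠ 0) (hαβ : α ≠ β)
    (S u : ℝ → EuclideanSpace ℝ (Fin n) → ℝ)
    (hS : ContDiffOn ℝ (⊤ : ℕ∞) (Function.uncurry S)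
      (Ioo (0 : ℝ) T ×ˢ (univ : Set (EuclideanSpace ℝ (Fin n)))))
    (hu : ContDiffOn ℝ (⊤ : ℕ∞) (Function.uncurry u)
      (Ioo (0 : ℝ) T ×ˢ (univ : Set (EuclideanSpace ℝ (Fin n)))))
    (hpde : ∀ τ ∈ Ioo (0 : ℝ) T, ∀ x,
      tderiv n u τ x = slap n u τ x - ‖sgrad n u τ x‖ ^ 2 - c * S τ x - γ * u τ x)
    (H : ℝ → EuclideanSpace ℝ (Fin n) → ℝ)
    (hH : H = fun τ x => α * slap n u τ x - β * ‖sgrad n u τ x‖ ^ 2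
      + a * S τ x + b * u τ x / τ + d * n / τ) :
    ∀ τ ∈ Ioo (0 : ℝ) T, ∀ x,
      tderiv n H τ x
        = slap n H τ x - 2 * ⟪sgrad n H τ x, sgrad n u τ x⟫
          - 2 * (α - β) *
            (∑ i, ∑ j, (shess n u τ x i j
              - (if i = j then lam / (2 * τ) else 0)) ^ 2)
          + 2 * (a + β * c) * ⟪sgrad n S τ x, sgrad n u τ x⟫
          - (2 * (α - β) * lam / (α * τ)) * H τ x
          + (α - β) * n * lam ^ 2 / (2 * τ ^ 2)
          + (b - 2 * (α - β) * lam * β / α) * ‖sgrad n u τ x‖ ^ 2 / τ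
          + (2 * (α - β) * a * lam / α - b * c) * S τ x / τ
          + (2 * (α - β) * lam / α - 1) * (b / τ ^ 2) * u τ x
          + (2 * (α - β) * lam / α - 1) * (d / τ ^ 2) * n
          - α * γ * slap n u τ x
          + 2 * β * γ * ‖sgrad n u τ x‖ ^ 2
          - b * γ * u τ x / τ
          + a * tderiv n S τ x
          - (a + α * c) * slap n S τ x := by
  intro τ hτ x
  set U := Function.uncurry u with hU
  set V := Function.uncurry S with hV
  have su : Sm n T U := hu
  have sS : Sm n T V := hS
  have sL : Sm n T (LL n U) := su.LL
  have sQ : Sm n T (GG n U U) := su.GG su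
  have hHeq : ∀ q ∈ Om n T, Function.uncurry H q = α * LL n U q + ((-β) * GG n U U q
      + (a * V q + (b * (U q * rr n q) + (d * n) * rr n q))) := by
    rintro ⟨t, y⟩ hq
    have ht := hq.1
    simp only [Function.uncurry_apply_pair, hH, slap_eq su ht, normsq_sgrad su ht, hU, hV, rr]
    ring
  have s5 : Sm n T (fun q => (d * n) * rr n q) := Sm_rr.cmul _
  have sUr : Sm n T (fun q => U q * rr n q) := su.mul Sm_rr
  have s4 : Sm n T (fun q => b * (U q * rr n q)) := sUr.cmul _
  have s45 := s4.add s5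
  have s3 : Sm n T (fun q => a * V q) := sS.cmul _
  have s345 := s3.add s45
  have s2 : Sm n T (fun q => (-β) * GG n U U q) := sQ.cmul _
  have s2345 := s2.add s345
  have s1 : Sm n T (fun q => α * LL n U q) := sL.cmul _
  have sH : Sm n T (Function.uncurry H) := ContDiffOn.congr (s1.add s2345) hHeq
  have hp := mem_Om (n := n) hτ x
  have hpde' : ∀ q ∈ Om n T, DD n (et n) U q = LL n U q + ((-1) * GG n U U q
      + ((-c) * V q + (-γ) * U q)) := by
    rintro ⟨t, y⟩ hq
    have ht := hq.1
    have := hpde t ht y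
    rw [tderiv_eq su ht, slap_eq su ht, normsq_sgrad su ht] at this
    rw [this]
    simp only [hU, hV, Function.uncurry_apply_pair]
    ring
  have r4 : Sm n T (fun q => (-γ) * U q) := su.cmul _
  have r3 : Sm n T (fun q => (-c) * V q) := sS.cmul _
  have r34 := r3.add r4
  have r2 : Sm n T (fun q => (-1) * GG n U U q) := sQ.cmul _
  have r234 := r2.add r34
  have tL : DD n (et n) (LL n U) (τ, x) = LL n (LL n U) (τ, x) + ((-1) * LL n (GG n U U) (τ, x)
      + ((-c) * LL n V (τ, x) + (-γ) * LL n U (τ, x))) := by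
    rw [DD_LL su _ hp, LL_congr hpde' hp, LL_add sL r234 hp, LL_add r2 r34 hp, LL_add r3 r4 hp,
      LL_cmul sQ _ hp, LL_cmul sS _ hp, LL_cmul su _ hp]
  have tQ : DD n (et n) (GG n U U) (τ, x) = 2 * (GG n (LL n U) U (τ, x)
      + ((-1) * GG n (GG n U U) U (τ, x)
      + ((-c) * GG n V U (τ, x) + (-γ) * GG n U U (τ, x)))) := by
    rw [DD_GG su _ hp, GG_congr hpde' hp, GG_add sL r234 hp, GG_add r2 r34 hp, GG_add r3 r4 hp,
      GG_cmul sQ _ hp, GG_cmul sS _ hp, GG_cmul su _ hp]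
  have tH := tderiv_eq sH hτ x
  rw [DD_congr hHeq _ hp, DD_add s1 s2345 _ hp, DD_add s2 s345 _ hp,
      DD_add s3 s45 _ hp, DD_add s4 s5 _ hp, DD_cmul sL _ _ hp, DD_cmul sQ _ _ hp,
      DD_cmul sS _ _ hp, DD_cmul sUr _ _ hp, DD_cmul Sm_rr _ _ hp, DD_mul su Sm_rr _ hp,
      DD_et_rr hp, tL, tQ, hpde' _ hp] at tH
  have lH := slap_eq sH hτ x
  rw [LL_congr hHeq hp, LL_add s1 s2345 hp, LL_add s2 s345 hp,
      LL_add s3 s45 hp, LL_add s4 s5 hp, LL_cmul sL _ hp, LL_cmul sQ _ hp,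
      LL_cmul sS _ hp, LL_cmul sUr _ hp, LL_cmul Sm_rr _ hp, LL_mul_rr su hp, LL_rr hp] at lH
  have gH := inner_sgrad sH su hτ x
  rw [← hU, GG_congr hHeq hp, GG_add s1 s2345 hp, GG_add s2 s345 hp,
      GG_add s3 s45 hp, GG_add s4 s5 hp, GG_cmul sL _ hp, GG_cmul sQ _ hp,
      GG_cmul sS _ hp, GG_cmul sUr _ hp, GG_cmul Sm_rr _ hp, GG_mul_rr su hp, GG_rr hp] at gH
  have hHv : H τ x = _ := hHeq (τ, x) hp
  have sq := square_expand (shess n u τ x) (lam / (2 * τ))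
  have sq2 : ∑ i, shess n u τ x i i = LL n U (τ, x) := slap_eq su hτ x
  have hB := LL_GG su hp
  have hs : ∀ i j, DD n (ex n i) (DD n (ex n j) U) (τ, x) = shess n u τ x i j :=
    fun i j => (shess_eq su hτ x i j).symm
  simp only [hs] at hB
  rw [sq2] at sq
  rw [tH, lH, gH, sq, hHv, inner_sgrad sS su hτ, normsq_sgrad su hτ, slap_eq su hτ,
    slap_eq sS hτ, tderiv_eq sS hτ, ← hU, ← hV, hB]
  have e1 : u τ x = U (τ, x) := rfl
  have e2 : S τ x = V (τ, x) := rfl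
  have hτ0 : τ ≠ 0 := hτ.1.ne'
  have e3 : rr n (τ, x) = τ⁻¹ := rfl
  rw [e1, e2, e3]
  field_simp
  ring
end
end

section
/- Let n ≥ 1 and T > 0. Let f : [0,T] × ℝⁿ → ℝ be smooth, ℤⁿ-periodic in the space variable, with 0 < f < 1 everywhere, satisfying the heat equation ∂_t f = Δf on [0,T] × ℝⁿ. Then for every t ∈ (0,T] and every x ∈ ℝⁿ: |∇(log f)(t,x)|² + (log f(t,x))/t ≤ 0. -/
open Set
open scoped RealInnerProductSpace

noncomputable section

lemma second_deriv_test (g g' : ℝ → ℝ) (A : ℝ) (hg : ∀ s, HasDerivAt g (g' s) s)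
    (hg' : HasDerivAt g' A 0) (hmax : ∀ s, g s ≤ g 0) : g' 0 = 0 ∧ A ≤ 0 := by
  have hd : deriv g = g' := funext fun s => (hg s).deriv
  have hlm : IsLocalMax g 0 := Filter.Eventually.of_forall hmax
  have h0 : g' 0 = 0 := hlm.hasDerivAt_eq_zero (hg 0)
  refine ⟨h0, ?_⟩
  by_contra hA
  push Not at hA
  have hmin : IsLocalMin g 0 := by
    apply isLocalMin_of_deriv_deriv_pos
    · rw [hd, hg'.deriv]; exact hA
    · rw [hd, h0]
    · exact (hg 0).continuousAt
  have hc : g =ᶠ[nhds 0] fun _ => g 0 := by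
    filter_upwards [hmin] with s hs
    exact le_antisymm (hmax s) hs
  have h2 : deriv g =ᶠ[nhds 0] deriv (fun _ => g 0) := hc.deriv
  have h3 := h2.deriv_eq
  rw [hd, hg'.deriv] at h3
  simp at h3
  linarith

lemma exists_translate (n : ℕ) (x : EuclideanSpace ℝ (Fin n)) : ∃ k : Fin n → ℤ,
    x + (WithLp.equiv 2 (Fin n → ℝ)).symm (fun i => (k i : ℝ)) ∈
      Metric.closedBall (0 : EuclideanSpace ℝ (Fin n)) (Real.sqrt n) := by
  refine ⟨fun i => -⌊x i⌋, ?_⟩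
  rw [mem_closedBall_zero_iff, EuclideanSpace.norm_eq]
  apply Real.sqrt_le_sqrt
  calc _ ≤ ∑ i : Fin n, (1 : ℝ) := by
        apply Finset.sum_le_sum
        intro i _
        have h1 := Int.floor_le (x i)
        have h2 := Int.lt_floor_add_one (x i)
        simp only [Real.norm_eq_abs, sq_abs]
        simp
        rw [← sub_eq_add_neg, abs_le]
        constructor <;> linarith
    _ = n := by simp

lemma log_line (n : ℕ) (u : EuclideanSpace ℝ (Fin n) → ℝ) (hu : ContDiff ℝ (⊤ : ℕ∞) u)
    (hp : ∀ x, 0 < u x) (x v : EuclideanSpace ℝ (Fin n)) :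
    (∀ s : ℝ, HasDerivAt (fun s : ℝ => Real.log (u (x + s • v)))
      (fderiv ℝ u (x + s • v) v / u (x + s • v)) s) ∧
    HasDerivAt (fun s : ℝ => fderiv ℝ u (x + s • v) v / u (x + s • v))
      (fderiv ℝ (fun y => fderiv ℝ u y v) x v / u x - (fderiv ℝ u x v / u x) ^ 2) 0 := by
  have hl : ∀ s : ℝ, HasDerivAt (fun s : ℝ => x + s • v) v s := fun s => by
    simpa using ((hasDerivAt_id s).smul_const v).const_add x
  have hd : ∀ s : ℝ, HasDerivAt (fun s : ℝ => u (x + s • v)) (fderiv ℝ u (x + s • v) v) s :=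
    fun s => ((hu.differentiable (by simp)) _).hasFDerivAt.comp_hasDerivAt s (hl s)
  refine ⟨fun s => (hd s).log (hp _).ne', ?_⟩
  have hu1 : ContDiff ℝ 1 (fun y => fderiv ℝ u y v) :=
    (hu.fderiv_right (m := 1) (by
      have : ((2 : ℕ∞) : WithTop ℕ∞) ≤ ((⊤ : ℕ∞) : WithTop ℕ∞) := WithTop.coe_le_coe.2 le_top
      convert this using 1; norm_num)).clm_apply contDiff_const
  have h2 : HasDerivAt (fun s : ℝ => fderiv ℝ u (x + s • v) v)
      (fderiv ℝ (fun y => fderiv ℝ u y v) (x + (0 : ℝ) • v) v) 0 :=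
    ((hu1.differentiable (by simp)) _).hasFDerivAt.comp_hasDerivAt (0 : ℝ) (hl 0)
  have h3 := h2.div (hd 0) (hp _).ne'
  have := (hp x).ne'
  refine h3.congr_deriv ?_
  simp only [zero_smul, add_zero]
  field_simp

section
variable (n : ℕ) (T : ℝ)
    (f : ℝ → EuclideanSpace ℝ (Fin n) → ℝ)

lemma slice_smooth (hf : ContDiffOn ℝ (⊤ : ℕ∞) (Function.uncurry f)
      (Icc (0 : ℝ) T ×ˢ (univ : Set (EuclideanSpace ℝ (Fin n))))) (t : ℝ) (ht : t ∈ Icc 0 T) :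
    ContDiff ℝ (⊤ : ℕ∞) (f t) := by
  rw [← contDiffOn_univ]
  have : f t = Function.uncurry f ∘ fun x => (t, x) := rfl
  rw [this]
  apply hf.comp (contDiff_const.prodMk contDiff_id).contDiffOn
  intro x _
  exact ⟨ht, mem_univ _⟩

lemma time_line (hf : ContDiffOn ℝ (⊤ : ℕ∞) (Function.uncurry f)
      (Icc (0 : ℝ) T ×ˢ (univ : Set (EuclideanSpace ℝ (Fin n))))) (t : ℝ) (ht : t ∈ Ioo 0 T)
    (x q : EuclideanSpace ℝ (Fin n)) :
    HasDerivAt (fun s => f s (x + s • q))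
      (tderiv n f t (x + t • q) + fderiv ℝ (f t) (x + t • q) q) t := by
  set y := x + t • q with hy
  have hF : DifferentiableAt ℝ (Function.uncurry f) (t, y) := by
    apply (hf.contDiffAt ?_).differentiableAt (by simp)
    exact prod_mem_nhds (Icc_mem_nhds ht.1 ht.2) Filter.univ_mem
  set L := fderiv ℝ (Function.uncurry f) (t, y)
  have hL : HasFDerivAt (Function.uncurry f) L (t, y) := hF.hasFDerivAt
  have h1 : HasDerivAt (fun s => f s y) (L (1, 0)) t :=
    hL.comp_hasDerivAt (f := fun s : ℝ => (s, y)) t ((hasDerivAt_id t).prodMk (hasDerivAt_const t y))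
  have h2 : HasFDerivAt (f t) (L.comp ((0 : EuclideanSpace ℝ (Fin n) →L[ℝ] ℝ).prod
      (ContinuousLinearMap.id ℝ _))) y :=
    hL.comp (f := fun z : EuclideanSpace ℝ (Fin n) => (t, z)) y
      ((hasFDerivAt_const t y).prodMk (hasFDerivAt_id y))
  have hl : HasDerivAt (fun s : ℝ => x + s • q) q t := by
    simpa using ((hasDerivAt_id t).smul_const q).const_add x
  have h3 : HasDerivAt (fun s => f s (x + s • q)) (L (1, q)) t :=
    HasFDerivAt.comp_hasDerivAt (f := fun s : ℝ => (s, x + s • q)) t (l := Function.uncurry f) hL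
      ((hasDerivAt_id t).prodMk hl)
  convert h3 using 1
  unfold tderiv
  rw [h1.deriv, h2.fderiv]
  simp only [ContinuousLinearMap.comp_apply, ContinuousLinearMap.prod_apply]
  rw [← map_add]
  simp

lemma my_fderiv_sum (L : EuclideanSpace ℝ (Fin n) →L[ℝ] ℝ) (q : EuclideanSpace ℝ (Fin n)) :
    L q = ∑ i, q i * L (e n i) := by
  have h : q = ∑ i, q i • e n i := by
    ext j
    simp [e, Finset.sum_apply, Pi.single_apply]
  conv_lhs => rw [h]
  simp

lemma phi_cont (hf : ContDiffOn ℝ (⊤ : ℕ∞) (Function.uncurry f)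
      (Icc (0 : ℝ) T ×ˢ (univ : Set (EuclideanSpace ℝ (Fin n)))))
    (hpos : ∀ t ∈ Icc (0 : ℝ) T, ∀ x, 0 < f t x) (a c : ℝ) (q : EuclideanSpace ℝ (Fin n)) :
    ContinuousOn (fun z : ℝ × EuclideanSpace ℝ (Fin n) =>
      a * Real.log (f z.1 z.2) - Real.log (f z.1 (z.2 + z.1 • q)) - c * z.1)
      (Icc (0 : ℝ) T ×ˢ univ) := by
  have h1 : ContinuousOn (fun z : ℝ × EuclideanSpace ℝ (Fin n) => f z.1 z.2)
      (Icc (0 : ℝ) T ×ˢ univ) := hf.continuousOn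
  have h2 : ContinuousOn (fun z : ℝ × EuclideanSpace ℝ (Fin n) => f z.1 (z.2 + z.1 • q))
      (Icc (0 : ℝ) T ×ˢ univ) := by
    refine hf.continuousOn.comp (f := fun z : ℝ × EuclideanSpace ℝ (Fin n) =>
      (z.1, z.2 + z.1 • q)) (by fun_prop) ?_
    intro z hz
    exact ⟨hz.1, mem_univ _⟩
  refine ((continuousOn_const.mul (h1.log ?_)).sub (h2.log ?_)).sub (by fun_prop)
  · intro z hz; exact (hpos _ hz.1 _).ne'
  · intro z hz; exact (hpos _ hz.1 _).ne'

lemma harnack_strict 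
    (hf : ContDiffOn ℝ (⊤ : ℕ∞) (Function.uncurry f)
      (Icc (0 : ℝ) T ×ˢ (univ : Set (EuclideanSpace ℝ (Fin n)))))
    (hpos : ∀ t ∈ Icc (0 : ℝ) T, ∀ x, 0 < f t x)
    (hlt : ∀ t ∈ Icc (0 : ℝ) T, ∀ x, f t x < 1)
    (hper : ∀ t ∈ Icc (0 : ℝ) T, ∀ x, ∀ k : Fin n → ℤ,
      f t (x + (WithLp.equiv 2 (Fin n → ℝ)).symm fun i => (k i : ℝ)) = f t x)
    (hpde : ∀ t ∈ Icc (0 : ℝ) T, ∀ x, tderiv n f t x = slap n f t x)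
    (ε : ℝ) (hε : 0 < ε) (w : EuclideanSpace ℝ (Fin n)) (c : ℝ)
    (hc : (1 + ε) * ε * ‖w‖ ^ 2 / 4 < c) (t : ℝ) (ht : t ∈ Ico 0 T)
    (x : EuclideanSpace ℝ (Fin n)) :
    (1 + ε) * Real.log (f t x) - Real.log (f t (x + t • (ε • w))) - c * t ≤ 0 := by
  set q := ε • w with hq
  set Φ : ℝ × EuclideanSpace ℝ (Fin n) → ℝ := fun z =>
      (1 + ε) * Real.log (f z.1 z.2) - Real.log (f z.1 (z.2 + z.1 • q)) - c * z.1 with hΦ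
  have hcont : ContinuousOn Φ (Icc (0 : ℝ) T ×ˢ univ) := phi_cont n T f hf hpos _ _ _
  have hsub : ∀ s ∈ Icc 0 t, s ∈ Icc 0 T := fun s hs => ⟨hs.1, hs.2.trans ht.2.le⟩
  obtain ⟨z0, hz0, hz0max⟩ := (isCompact_Icc.prod
    (isCompact_closedBall (0 : EuclideanSpace ℝ (Fin n)) (Real.sqrt n))).exists_isMaxOn
    (s := Icc 0 t ×ˢ Metric.closedBall (0 : EuclideanSpace ℝ (Fin n)) (Real.sqrt n))
    ⟨(0, 0), ⟨left_mem_Icc.2 ht.1, by simp⟩⟩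
    (hcont.mono (prod_mono (fun s hs => hsub s hs) (subset_univ _)))
  obtain ⟨t0, x0⟩ := z0
  have ht0 : t0 ∈ Icc 0 t := hz0.1
  have hmax : ∀ s ∈ Icc 0 t, ∀ y, Φ (s, y) ≤ Φ (t0, x0) := by
    intro s hs y
    obtain ⟨k, hk⟩ := exists_translate n y
    have h1 := hz0max (show (s, _) ∈ _ from ⟨hs, hk⟩)
    have h2 : Φ (s, y + (WithLp.equiv 2 (Fin n → ℝ)).symm fun i => (k i : ℝ)) = Φ (s, y) := by
      simp only [hΦ]
      rw [add_right_comm, hper s (hsub s hs), hper s (hsub s hs)]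
    rw [← h2]
    exact h1
  have hgoal : Φ (t, x) ≤ Φ (t0, x0) := hmax t (right_mem_Icc.2 ht.1) x
  refine le_trans hgoal ?_
  rcases ht0.1.eq_or_lt with h0 | h0
  · simp only [hΦ, ← h0]
    have h00 : (0 : ℝ) ∈ Icc 0 T := hsub 0 (left_mem_Icc.2 ht.1)
    have := Real.log_neg (hpos 0 h00 x0) (hlt 0 h00 x0)
    simp
    nlinarith
  exfalso
  have ht0T : t0 ∈ Ioo 0 T := ⟨h0, ht0.2.trans_lt ht.2⟩
  have ht0' : t0 ∈ Icc 0 T := hsub _ ht0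
  have hu := slice_smooth n T f hf t0 ht0'
  have hup := hpos t0 ht0'
  set y0 := x0 + t0 • q with hy0
  -- spatial
  have hsp : ∀ i, (1 + ε) * (fderiv ℝ (f t0) x0 (e n i) / f t0 x0)
        - fderiv ℝ (f t0) y0 (e n i) / f t0 y0 = 0 ∧
      (1 + ε) * (shess n f t0 x0 i i / f t0 x0 - (fderiv ℝ (f t0) x0 (e n i) / f t0 x0) ^ 2)
        - (shess n f t0 y0 i i / f t0 y0 - (fderiv ℝ (f t0) y0 (e n i) / f t0 y0) ^ 2) ≤ 0 := by
    intro i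
    obtain ⟨a1, a2⟩ := log_line n (f t0) hu hup x0 (e n i)
    obtain ⟨b1, b2⟩ := log_line n (f t0) hu hup y0 (e n i)
    have := second_deriv_test _ _ _ (fun s => ((a1 s).const_mul (1 + ε)).sub (b1 s))
      ((a2.const_mul (1 + ε)).sub b2) (by
        intro s
        have := hmax t0 ht0 (x0 + s • e n i)
        simp only [hΦ] at this
        rw [add_right_comm, ← hy0] at this
        simp
        linarith)
    simpa [shess] using this
  -- time
  have htm : 0 ≤ (1 + ε) * (slap n f t0 x0 / f t0 x0)
      - (slap n f t0 y0 + fderiv ℝ (f t0) y0 q) / f t0 y0 - c := by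
    have d1 := time_line n T f hf t0 ht0T x0 0
    simp only [smul_zero, add_zero, map_zero] at d1
    have d2 := time_line n T f hf t0 ht0T x0 q
    rw [← hy0] at d2
    rw [hpde t0 ht0'] at d1 d2
    have d3 := (((d1.log (hup _).ne').const_mul (1 + ε)).sub (d2.log (hup _).ne')).sub
      ((hasDerivAt_id t0).const_mul c)
    rw [mul_one] at d3
    have d4 := d3.hasDerivWithinAt (s := Iio t0)
    rw [hasDerivWithinAt_iff_tendsto_slope' (by simp)] at d4
    refine ge_of_tendsto d4 ?_
    filter_upwards [Ioo_mem_nhdsLT h0] with s hs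
    have := hmax s ⟨hs.1.le, hs.2.le.trans ht0.2⟩ x0
    simp only [hΦ] at this
    rw [slope_def_field]
    apply div_nonneg_of_nonpos
    · simpa using this
    · linarith [hs.2]
  rw [my_fderiv_sum n (fderiv ℝ (f t0) y0) q] at htm
  unfold slap at htm
  have hnorm : ‖w‖ ^ 2 = ∑ i, w i ^ 2 := by
    rw [EuclideanSpace.norm_sq_eq]; simp
  have key : ∀ i, (1 + ε) * (shess n f t0 x0 i i / f t0 x0)
      - (shess n f t0 y0 i i + q i * fderiv ℝ (f t0) y0 (e n i)) / f t0 y0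
      ≤ (1 + ε) * ε / 4 * w i ^ 2 := by
    intro i
    obtain ⟨h1, h2⟩ := hsp i
    have hqi : q i = ε * w i := by simp [hq]
    rw [hqi]
    have hdiv : (shess n f t0 y0 i i + ε * w i * fderiv ℝ (f t0) y0 (e n i)) / f t0 y0
      = shess n f t0 y0 i i / f t0 y0 + ε * w i * (fderiv ℝ (f t0) y0 (e n i) / f t0 y0) := by ring
    rw [hdiv]
    generalize fderiv ℝ (f t0) x0 (e n i) / f t0 x0 = p at *
    have h3 : fderiv ℝ (f t0) y0 (e n i) / f t0 y0 = (1 + ε) * p := by linarith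
    rw [h3] at h2 ⊢
    have : 0 ≤ (1 + ε) * ε * (p + w i / 2) ^ 2 := by positivity
    nlinarith
  have hsum := Finset.sum_le_sum (s := Finset.univ) fun i _ => key i
  rw [Finset.sum_sub_distrib, ← Finset.mul_sum, ← Finset.mul_sum, ← Finset.sum_div,
    ← Finset.sum_div, Finset.sum_add_distrib, ← hnorm] at hsum
  linarith

lemma harnack (hT : 0 < T)
    (hf : ContDiffOn ℝ (⊤ : ℕ∞) (Function.uncurry f)
      (Icc (0 : ℝ) T ×ˢ (univ : Set (EuclideanSpace ℝ (Fin n)))))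
    (hpos : ∀ t ∈ Icc (0 : ℝ) T, ∀ x, 0 < f t x)
    (hlt : ∀ t ∈ Icc (0 : ℝ) T, ∀ x, f t x < 1)
    (hper : ∀ t ∈ Icc (0 : ℝ) T, ∀ x, ∀ k : Fin n → ℤ,
      f t (x + (WithLp.equiv 2 (Fin n → ℝ)).symm fun i => (k i : ℝ)) = f t x)
    (hpde : ∀ t ∈ Icc (0 : ℝ) T, ∀ x, tderiv n f t x = slap n f t x)
    (ε : ℝ) (hε : 0 < ε) (w : EuclideanSpace ℝ (Fin n)) (t : ℝ) (ht : t ∈ Icc 0 T)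
    (x : EuclideanSpace ℝ (Fin n)) :
    (1 + ε) * Real.log (f t x) - Real.log (f t (x + t • (ε • w)))
      - (1 + ε) * ε * ‖w‖ ^ 2 / 4 * t ≤ 0 := by
  set C := (1 + ε) * ε * ‖w‖ ^ 2 / 4
  have h1 : ∀ c, C < c →
      (1 + ε) * Real.log (f t x) - Real.log (f t (x + t • (ε • w))) - c * t ≤ 0 := by
    intro c hc
    have hcont : ContinuousOn (fun s : ℝ => (1 + ε) * Real.log (f s x)
        - Real.log (f s (x + s • (ε • w))) - c * s) (Icc 0 T) :=
      (phi_cont n T f hf hpos (1 + ε) c (ε • w)).comp (f := fun s : ℝ => (s, x)) (by fun_prop)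
        (fun s hs => ⟨hs, mem_univ _⟩)
    rw [← closure_Ico hT.ne] at hcont ht
    exact ContinuousWithinAt.closure_le ht ((hcont t ht).mono subset_closure)
      continuousWithinAt_const fun s hs =>
      harnack_strict n T f hf hpos hlt hper hpde ε hε w c hc s hs x
  have h2 : Filter.Tendsto (fun c => (1 + ε) * Real.log (f t x)
      - Real.log (f t (x + t • (ε • w))) - c * t) (nhdsWithin C (Ioi C))
      (nhds ((1 + ε) * Real.log (f t x) - Real.log (f t (x + t • (ε • w))) - C * t)) := by
    apply Filter.Tendsto.mono_left _ nhdsWithin_le_nhds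
    apply Continuous.tendsto
    fun_prop
  refine le_of_tendsto h2 ?_
  filter_upwards [self_mem_nhdsWithin] with c hc
  exact h1 c hc

end

theorem gradient_estimate_heat_torus (n : ℕ) (hn : 1 ≤ n) (T : ℝ) (hT : 0 < T)
    (f : ℝ → EuclideanSpace ℝ (Fin n) → ℝ)
    (hf : ContDiffOn ℝ (⊤ : ℕ∞) (Function.uncurry f)
      (Icc (0 : ℝ) T ×ˢ (univ : Set (EuclideanSpace ℝ (Fin n)))))
    (hpos : ∀ t ∈ Icc (0 : ℝ) T, ∀ x, 0 < f t x)
    (hlt : ∀ t ∈ Icc (0 : ℝ) T, ∀ x, f t x < 1)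
    (hper : ∀ t ∈ Icc (0 : ℝ) T, ∀ x, ∀ k : Fin n → ℤ,
      f t (x + (WithLp.equiv 2 (Fin n → ℝ)).symm fun i => (k i : ℝ)) = f t x)
    (hpde : ∀ t ∈ Icc (0 : ℝ) T, ∀ x, tderiv n f t x = slap n f t x) :
    ∀ t ∈ Ioc (0 : ℝ) T, ∀ x,
      ‖sgrad n (fun s y => Real.log (f s y)) t x‖ ^ 2
        + Real.log (f t x) / t ≤ 0 := by
  intro t ht x
  have ht' : t ∈ Icc 0 T := Ioc_subset_Icc_self ht
  have ht0 : 0 < t := ht.1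
  have hu := slice_smooth n T f hf t ht'
  set G := sgrad n (fun s y => Real.log (f s y)) t x with hG
  have hlog : HasGradientAt (fun y => Real.log (f t y)) G x := by
    apply DifferentiableAt.hasGradientAt
    exact ((hu.differentiable (by simp)) x).log (hpos t ht' x).ne'
  set w : EuclideanSpace ℝ (Fin n) := (-2 : ℝ) • G with hw
  have hl : HasDerivAt (fun ε : ℝ => x + t • (ε • w)) (t • w) 0 := by
    simpa using (((hasDerivAt_id (0 : ℝ)).smul_const w).const_smul t).const_add x
  have hd : HasDerivAt (fun ε : ℝ => Real.log (f t (x + t • (ε • w)))) (inner ℝ G (t • w)) 0 := by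
    have h1 : HasFDerivAt (fun y => Real.log (f t y)) (InnerProductSpace.toDual ℝ _ G)
      (x + t • ((0 : ℝ) • w)) := by simpa using hlog.hasFDerivAt
    have := h1.comp_hasDerivAt (0 : ℝ) hl
    refine this.congr_deriv ?_
    simp [inner_smul_right]
  have hs := hd.hasDerivWithinAt (s := Ioi 0)
  rw [hasDerivWithinAt_iff_tendsto_slope' (by simp)] at hs
  have hr : Filter.Tendsto (fun ε : ℝ => Real.log (f t x) - (1 + ε) * ‖w‖ ^ 2 / 4 * t)
      (nhdsWithin 0 (Ioi 0)) (nhds (Real.log (f t x) - (1 + 0) * ‖w‖ ^ 2 / 4 * t)) := by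
    apply Filter.Tendsto.mono_left _ nhdsWithin_le_nhds
    apply Continuous.tendsto (f := fun ε : ℝ => Real.log (f t x) - (1 + ε) * ‖w‖ ^ 2 / 4 * t)
    fun_prop
  have hle : Real.log (f t x) - (1 + 0) * ‖w‖ ^ 2 / 4 * t ≤ inner ℝ G (t • w) := by
    refine le_of_tendsto_of_tendsto hr hs ?_
    filter_upwards [self_mem_nhdsWithin] with ε hε
    have hε' : 0 < ε := hε
    have := harnack n T f hT hf hpos hlt hper hpde ε hε' w t ht' x
    rw [slope_def_field]
    simp only [zero_smul, smul_zero, add_zero, sub_zero]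
    rw [le_div_iff₀ hε']
    nlinarith
  have hnw : ‖w‖ ^ 2 = 4 * ‖G‖ ^ 2 := by
    rw [hw, norm_smul, mul_pow]; norm_num
  rw [hnw, hw, inner_smul_right, inner_smul_right, real_inner_self_eq_norm_sq] at hle
  have : Real.log (f t x) / t ≤ - ‖G‖ ^ 2 := by
    rw [div_le_iff₀ ht0]; nlinarith
  linarith
end
end

section
/- Let n ≥ 1, T > 0, and let γ > 0 be a real constant. Let f : [0,T] × ℝⁿ → ℝ be smooth, ℤⁿ-periodic in the space variable, with 0 < f < 1 everywhere, satisfying ∂_t f = Δf − γ·f·log f on [0,T] × ℝⁿ. Then for every t ∈ (0,T] and every x ∈ ℝⁿ: |∇(log f)(t,x)|² + (log f(t,x))/t ≤ 0. -/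
open Set
open scoped RealInnerProductSpace

noncomputable section

open Filter Topology in
/-- second derivative test: necessary condition at a local maximum -/
lemma second_deriv_nonpos_of_isLocalMax {g : ℝ → ℝ} {a : ℝ} (hc : ContinuousAt g a)
    (h : IsLocalMax g a) : deriv (deriv g) a ≤ 0 := by
  by_contra! hpos
  have hd : deriv g a = 0 := h.deriv_eq_zero
  have hmin := isLocalMin_of_deriv_deriv_pos hpos hd hc
  have hev : g =ᶠ[𝓝 a] fun _ => g a := by
    filter_upwards [h, hmin] with x h1 h2
    exact le_antisymm h1 h2
  have h1 : deriv g =ᶠ[𝓝 a] deriv (fun _ => g a) := hev.deriv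
  have h2 := h1.deriv_eq
  simp at h2
  linarith

section Dir
variable {W : Type*} [NormedAddCommGroup W] [NormedSpace ℝ W]

/-- directional derivative -/
def dd (v : W) (G : W → ℝ) : W → ℝ := fun p => fderiv ℝ G p v

lemma dd_smooth {O : Set W} (hO : IsOpen O) {G : W → ℝ} (v : W)
    (hG : ContDiffOn ℝ (⊤ : ℕ∞) G O) : ContDiffOn ℝ (⊤ : ℕ∞) (dd v G) O := by
  have h := hG.fderiv_of_isOpen (m := (⊤ : ℕ∞)) hO (by simp)
  exact h.clm_apply contDiffOn_const

lemma smooth_da {O : Set W} (hO : IsOpen O) {G : W → ℝ}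
    (hG : ContDiffOn ℝ (⊤ : ℕ∞) G O) {p : W} (hp : p ∈ O) : DifferentiableAt ℝ G p :=
  (hG.contDiffAt (hO.mem_nhds hp)).differentiableAt (by simp)

lemma dd_comm {O : Set W} (hO : IsOpen O) {G : W → ℝ} (v w : W)
    (hG : ContDiffOn ℝ (⊤ : ℕ∞) G O) {p : W} (hp : p ∈ O) :
    dd v (dd w G) p = dd w (dd v G) p := by
  have hA := hG.contDiffAt (hO.mem_nhds hp)
  have hs : IsSymmSndFDerivAt ℝ G p := hA.isSymmSndFDerivAt (by
    rw [minSmoothness_of_isRCLikeNormedField]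
    exact WithTop.coe_le_coe.2 (le_top : (2 : ℕ∞) ≤ ⊤))
  have h := hG.fderiv_of_isOpen (m := (⊤ : ℕ∞)) hO (by simp)
  have hd : DifferentiableAt ℝ (fderiv ℝ G) p :=
    (h.contDiffAt (hO.mem_nhds hp)).differentiableAt (by simp)
  have key : ∀ v w : W, dd v (dd w G) p = fderiv ℝ (fderiv ℝ G) p v w := by
    intro v w
    have := (hd.hasFDerivAt.clm_apply (hasFDerivAt_const w p)).fderiv
    unfold dd
    rw [this]; simp
  rw [key, key]; exact hs v w

lemma dd_congr {O : Set W} (hO : IsOpen O) {G G' : W → ℝ} (v : W)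
    (h : ∀ p ∈ O, G p = G' p) {p : W} (hp : p ∈ O) : dd v G p = dd v G' p := by
  have : G =ᶠ[nhds p] G' := by
    filter_upwards [hO.mem_nhds hp] with q hq using h q hq
  unfold dd; rw [this.fderiv_eq]

lemma dd_add {G G' : W → ℝ} (v : W) {p : W} (h : DifferentiableAt ℝ G p)
    (h' : DifferentiableAt ℝ G' p) :
    dd v (fun q => G q + G' q) p = dd v G p + dd v G' p := by
  unfold dd; rw [fderiv_fun_add h h']; simp

lemma dd_mul {G G' : W → ℝ} (v : W) {p : W} (h : DifferentiableAt ℝ G p)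
    (h' : DifferentiableAt ℝ G' p) :
    dd v (fun q => G q * G' q) p = G p * dd v G' p + dd v G p * G' p := by
  unfold dd; rw [fderiv_fun_mul h h']; simp; ring

lemma dd_cmul {G : W → ℝ} (c : ℝ) (v : W) {p : W} (h : DifferentiableAt ℝ G p) :
    dd v (fun q => c * G q) p = c * dd v G p := by
  unfold dd; rw [fderiv_const_mul h]; simp

lemma dd_sum {ι : Type*} [Fintype ι] {G : ι → W → ℝ} (v : W) {p : W}
    (h : ∀ i, DifferentiableAt ℝ (G i) p) :
    dd v (fun q => ∑ i, G i q) p = ∑ i, dd v (G i) p := by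
  unfold dd; rw [fderiv_fun_sum (fun i _ => h i)]; simp

lemma dd_sq {G : W → ℝ} (v : W) {p : W} (h : DifferentiableAt ℝ G p) :
    dd v (fun q => G q ^ 2) p = 2 * (G p * dd v G p) := by
  have := dd_mul v h h
  simp only [← pow_two] at this
  rw [this]; ring

lemma dd_line {G : W → ℝ} (p v : W) (s : ℝ) (h : DifferentiableAt ℝ G (p + s • v)) :
    HasDerivAt (fun s : ℝ => G (p + s • v)) (dd v G (p + s • v)) s := by
  have h1 : HasDerivAt (fun s : ℝ => p + s • v) v s := by
    simpa using ((hasDerivAt_id s).smul_const v).const_add p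
  exact h.hasFDerivAt.comp_hasDerivAt s h1

/-- along an unconstrained direction the first derivative vanishes, the second is nonpositive -/
lemma dd_max {O : Set W} (hO : IsOpen O) {G : W → ℝ} (v p : W)
    (hG : ContDiffOn ℝ (⊤ : ℕ∞) G O) (hp : p ∈ O)
    (hm : ∀ s : ℝ, p + s • v ∈ O → G (p + s • v) ≤ G p) :
    dd v G p = 0 ∧ dd v (dd v G) p ≤ 0 := by
  have hcont : Continuous (fun s : ℝ => p + s • v) := by fun_prop
  have hev : ∀ᶠ s : ℝ in nhds 0, p + s • v ∈ O :=
    (hO.preimage hcont).mem_nhds (by simpa using hp)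
  have hloc : IsLocalMax (fun s : ℝ => G (p + s • v)) 0 := by
    filter_upwards [hev] with s hs
    simpa using hm s hs
  have h0 : p + (0 : ℝ) • v = p := by simp
  have hd0 := dd_line p v 0 (G := G) (by rw [h0]; exact smooth_da hO hG hp)
  have hd1 := dd_line p v 0 (G := dd v G) (by rw [h0]; exact smooth_da hO (dd_smooth hO v hG) hp)
  have h2 := second_deriv_nonpos_of_isLocalMax hd0.continuousAt hloc
  have he : deriv (fun s : ℝ => G (p + s • v)) =ᶠ[nhds 0] fun s => dd v G (p + s • v) := by
    filter_upwards [hev] with s hs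
    exact (dd_line p v s (smooth_da hO hG hs)).deriv
  rw [he.deriv_eq, hd1.deriv, h0] at h2
  have h1 := hloc.deriv_eq_zero
  rw [hd0.deriv, h0] at h1
  exact ⟨h1, h2⟩

/-- one-sided maximum in a direction -/
lemma dd_max_left {O : Set W} (hO : IsOpen O) {G : W → ℝ} (v p : W)
    (hG : ContDiffOn ℝ (⊤ : ℕ∞) G O) (hp : p ∈ O)
    (hm : ∀ s : ℝ, s ≤ 0 → p + s • v ∈ O → G (p + s • v) ≤ G p) :
    0 ≤ dd v G p := by
  have hcont : Continuous (fun s : ℝ => p + s • v) := by fun_prop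
  have hev : ∀ᶠ s : ℝ in nhds 0, p + s • v ∈ O :=
    (hO.preimage hcont).mem_nhds (by simpa using hp)
  have h0 : p + (0 : ℝ) • v = p := by simp
  have hloc : IsLocalMaxOn (fun s : ℝ => G (p + s • v)) (Iic 0) 0 := by
    filter_upwards [mem_nhdsWithin_of_mem_nhds hev, self_mem_nhdsWithin] with s hs hs'
    simpa using hm s hs' hs
  have hd0 := dd_line p v 0 (G := G) (by rw [h0]; exact smooth_da hO hG hp)
  have := hloc.hasFDerivWithinAt_nonpos (y := (-1 : ℝ)) hd0.hasFDerivAt.hasFDerivWithinAt (by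
    apply mem_posTangentConeAt_of_segment_subset
    rw [segment_symm, segment_eq_Icc (by norm_num)]
    intro x hx; simpa using hx.2)
  rw [h0] at this
  simpa using this

end Dir

lemma key_sums {n : ℕ} (a : Fin n → ℝ) (h c : Fin n → Fin n → ℝ) (t γ u : ℝ) (ht : 0 < t)
    (hγ : 0 < γ)
    (h0 : 0 ≤ ∑ j, a j ^ 2 + t * ∑ j, 2 * (a j * (∑ i, c i j + ∑ i, 2 * (a i * h j i) - γ * a j))
      + (∑ i, h i i + ∑ i, a i ^ 2 - γ * u))
    (h1 : ∀ i, t * ∑ j, 2 * (a j * h i j) + a i = 0)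
    (h2 : ∀ i, t * ∑ j, 2 * (a j * c i j + h i j * h i j) + h i i ≤ 0) :
    t * ∑ j, a j ^ 2 + u ≤ 0 := by
  have s1 : ∑ i, a i * (t * ∑ j, 2 * (a j * h i j) + a i) = 0 :=
    Finset.sum_eq_zero (fun i _ => by rw [h1 i, mul_zero])
  have s2 : ∑ i, (t * ∑ j, 2 * (a j * c i j + h i j * h i j) + h i i) ≤ 0 :=
    Finset.sum_nonpos (fun i _ => h2 i)
  have s3 : 0 ≤ ∑ i, ∑ j, h i j * h i j :=
    Finset.sum_nonneg fun i _ => Finset.sum_nonneg fun j _ => mul_self_nonneg _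
  have s4 : 0 ≤ ∑ j, a j ^ 2 := Finset.sum_nonneg fun j _ => sq_nonneg _
  have e1 : ∑ i, a i * (t * ∑ j, 2 * (a j * h i j) + a i)
      = 2 * t * (∑ i, ∑ j, a i * a j * h i j) + ∑ j, a j ^ 2 := by
    simp only [Finset.mul_sum, mul_add, Finset.sum_add_distrib]
    congr 1
    · refine Finset.sum_congr rfl fun i _ => Finset.sum_congr rfl fun j _ => by ring
    · refine Finset.sum_congr rfl fun i _ => by ring
  have e2 : ∑ i, (t * ∑ j, 2 * (a j * c i j + h i j * h i j) + h i i)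
      = 2 * t * (∑ i, ∑ j, a j * c i j) + 2 * t * (∑ i, ∑ j, h i j * h i j) + ∑ i, h i i := by
    simp only [Finset.mul_sum, mul_add, Finset.sum_add_distrib]
    congr 2
    · refine Finset.sum_congr rfl fun i _ => Finset.sum_congr rfl fun j _ => by ring
    · refine Finset.sum_congr rfl fun i _ => Finset.sum_congr rfl fun j _ => by ring
  have e0 : ∑ j, 2 * (a j * (∑ i, c i j + ∑ i, 2 * (a i * h j i) - γ * a j))
      = 2 * (∑ i, ∑ j, a j * c i j) + 4 * (∑ i, ∑ j, a i * a j * h i j)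
        - 2 * γ * ∑ j, a j ^ 2 := by
    rw [Finset.sum_comm (f := fun i j => a j * c i j)]
    simp only [Finset.mul_sum, mul_add, mul_sub, Finset.sum_add_distrib, Finset.sum_sub_distrib]
    congr 1
    · congr 1
      refine Finset.sum_congr rfl fun i _ => Finset.sum_congr rfl fun j _ => by ring
    · refine Finset.sum_congr rfl fun i _ => by ring
  rw [e1] at s1; rw [e2] at s2; rw [e0] at h0
  have s5 : 0 ≤ t * ∑ i, ∑ j, h i j * h i j := by positivity
  have s6 : 0 ≤ γ * (t * ∑ j, a j ^ 2) := by positivity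
  by_contra! hc
  have s7 := mul_pos hγ hc
  nlinarith

lemma key_max (n : ℕ) (T γ : ℝ) (hγ : 0 < γ) (U : ℝ × EuclideanSpace ℝ (Fin n) → ℝ)
    (hU : ContDiffOn ℝ (⊤ : ℕ∞) U (Ioo 0 T ×ˢ univ))
    (hpde : ∀ p ∈ Ioo 0 T ×ˢ (univ : Set (EuclideanSpace ℝ (Fin n))),
      dd (1, 0) U p = ∑ i, dd (0, e n i) (dd (0, e n i) U) p + ∑ i, (dd (0, e n i) U p) ^ 2
        + (-γ) * U p)
    (p : ℝ × EuclideanSpace ℝ (Fin n)) (hp : p ∈ Ioo 0 T ×ˢ (univ : Set (EuclideanSpace ℝ (Fin n))))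
    (hm : ∀ q ∈ Ioo 0 T ×ˢ (univ : Set (EuclideanSpace ℝ (Fin n))), q.1 ≤ p.1 →
      q.1 * ∑ i, (dd (0, e n i) U q) ^ 2 + U q ≤ p.1 * ∑ i, (dd (0, e n i) U p) ^ 2 + U p) :
    p.1 * ∑ i, (dd (0, e n i) U p) ^ 2 + U p ≤ 0 := by
  set O := Ioo 0 T ×ˢ (univ : Set (EuclideanSpace ℝ (Fin n))) with hOdef
  have hO : IsOpen O := isOpen_Ioo.prod isOpen_univ
  set V : Fin n → ℝ × EuclideanSpace ℝ (Fin n) := fun i => (0, e n i) with hV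
  have sA : ∀ i, ContDiffOn ℝ (⊤ : ℕ∞) (dd (V i) U) O := fun i => dd_smooth hO _ hU
  have sH : ∀ i j, ContDiffOn ℝ (⊤ : ℕ∞) (dd (V i) (dd (V j) U)) O :=
    fun i j => dd_smooth hO _ (sA j)
  have sF : ContDiffOn ℝ (⊤ : ℕ∞) (fun q : ℝ × EuclideanSpace ℝ (Fin n) => q.1) O :=
    contDiff_fst.contDiffOn
  have sS : ContDiffOn ℝ (⊤ : ℕ∞) (fun q => ∑ i, (dd (V i) U q) ^ 2) O :=
    ContDiffOn.sum fun i _ => (sA i).pow 2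
  set H : ℝ × EuclideanSpace ℝ (Fin n) → ℝ :=
    fun q => q.1 * ∑ i, (dd (V i) U q) ^ 2 + U q with hHdef
  have hH : ContDiffOn ℝ (⊤ : ℕ∞) H O := (sF.mul sS).add hU
  have da : ∀ {G : ℝ × EuclideanSpace ℝ (Fin n) → ℝ}, ContDiffOn ℝ (⊤ : ℕ∞) G O → ∀ {q}, q ∈ O →
    DifferentiableAt ℝ G q := by
    intro G hG q hq
    exact smooth_da hO hG hq
  have dfst : ∀ (v q : ℝ × EuclideanSpace ℝ (Fin n)),
      dd v (fun q : ℝ × EuclideanSpace ℝ (Fin n) => q.1) q = v.1 := by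
    intro v q
    have : fderiv ℝ (fun q : ℝ × EuclideanSpace ℝ (Fin n) => q.1) q
      = ContinuousLinearMap.fst ℝ ℝ (EuclideanSpace ℝ (Fin n)) := fderiv_fst
    unfold dd; rw [this]; rfl
  -- first derivative of H
  have dH : ∀ v, ∀ q ∈ O, dd v H q =
      q.1 * (∑ j, 2 * (dd (V j) U q * dd v (dd (V j) U) q)) + v.1 * ∑ j, (dd (V j) U q) ^ 2
        + dd v U q := by
    intro v q hq
    rw [hHdef, dd_add v ((da sF hq).fun_mul (da sS hq)) (da hU hq), dd_mul v (da sF hq) (da sS hq),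
      dd_sum v (fun i => (da (sA i) hq).fun_pow 2), dfst]
    simp only [dd_sq v (da (sA _) hq)]
  have dHi : ∀ i, ∀ q ∈ O, dd (V i) H q =
      q.1 * (∑ j, 2 * (dd (V j) U q * dd (V i) (dd (V j) U) q)) + dd (V i) U q := by
    intro i q hq
    rw [dH _ q hq]; simp [hV]
  have ddHi : ∀ i, dd (V i) (dd (V i) H) p =
      p.1 * (∑ j, 2 * (dd (V j) U p * dd (V i) (dd (V i) (dd (V j) U)) p +
        dd (V i) (dd (V j) U) p * dd (V i) (dd (V j) U) p)) + dd (V i) (dd (V i) U) p := by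
    intro i
    have s2 : ∀ j, ContDiffOn ℝ (⊤ : ℕ∞)
      (fun q => dd (V j) U q * dd (V i) (dd (V j) U) q) O := fun j => (sA j).mul (sH i j)
    have s3 : ∀ j, ContDiffOn ℝ (⊤ : ℕ∞)
      (fun q => 2 * (dd (V j) U q * dd (V i) (dd (V j) U) q)) O :=
      fun j => contDiffOn_const.mul (s2 j)
    have s4 : ContDiffOn ℝ (⊤ : ℕ∞)
      (fun q => ∑ j, 2 * (dd (V j) U q * dd (V i) (dd (V j) U) q)) O :=
      ContDiffOn.sum fun j _ => s3 j
    rw [dd_congr hO (V i) (dHi i) hp, dd_add _ ((da sF hp).fun_mul (da s4 hp)) (da (sA i) hp),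
      dd_mul _ (da sF hp) (da s4 hp), dd_sum _ (fun j => da (s3 j) hp), dfst]
    have : ∀ j, dd (V i) (fun q => 2 * (dd (V j) U q * dd (V i) (dd (V j) U) q)) p
      = 2 * (dd (V j) U p * dd (V i) (dd (V i) (dd (V j) U)) p +
        dd (V i) (dd (V j) U) p * dd (V i) (dd (V j) U) p) := fun j => by
      rw [dd_cmul _ _ (da (s2 j) hp), dd_mul _ (da (sA j) hp) (da (sH i j) hp)]
    simp only [this]
    simp [hV]
  -- derivative of the equation
  have dpde : ∀ j, dd (1, 0) (dd (V j) U) p = ∑ i, dd (V i) (dd (V i) (dd (V j) U)) p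
      + ∑ i, 2 * (dd (V i) U p * dd (V j) (dd (V i) U) p) - γ * dd (V j) U p := by
    intro j
    have s5 : ContDiffOn ℝ (⊤ : ℕ∞) (fun q => ∑ i, dd (V i) (dd (V i) U) q) O :=
      ContDiffOn.sum fun i _ => sH i i
    have s6 : ContDiffOn ℝ (⊤ : ℕ∞) (fun q => (-γ) * U q) O := contDiffOn_const.mul hU
    rw [dd_comm hO _ _ hU hp, dd_congr hO (V j) hpde hp]
    change dd (V j) (fun q => ∑ i, dd (V i) (dd (V i) U) q + ∑ i, (dd (V i) U q) ^ 2
      + (-γ) * U q) p = _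
    rw [dd_add _ ((da s5 hp).fun_add (da sS hp)) (da s6 hp), dd_add _ (da s5 hp) (da sS hp),
      dd_sum _ (fun i => da (sH i i) hp), dd_sum _ (fun i => (da (sA i) hp).fun_pow 2),
      dd_cmul _ _ (da hU hp)]
    simp only [dd_sq _ (da (sA _) hp)]
    have : ∀ i, dd (V j) (dd (V i) (dd (V i) U)) p = dd (V i) (dd (V i) (dd (V j) U)) p := by
      intro i
      rw [dd_comm hO _ _ (sA i) hp]
      exact dd_congr hO _ (fun q hq => dd_comm hO _ _ hU hq) hp
    simp only [this]; ring
  have hmx : ∀ i, dd (V i) H p = 0 ∧ dd (V i) (dd (V i) H) p ≤ 0 := fun i =>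
    dd_max hO _ _ hH hp fun s hs => hm _ hs (by simp [hV])
  have hmt : 0 ≤ dd (1, 0) H p :=
    dd_max_left hO _ _ hH hp fun s hs hs' => hm _ hs' (by simpa using hs)
  rw [dH _ p hp] at hmt
  simp only [dpde] at hmt
  rw [hpde p hp] at hmt
  refine key_sums (fun i => dd (V i) U p) (fun i j => dd (V i) (dd (V j) U) p)
    (fun i j => dd (V i) (dd (V i) (dd (V j) U)) p) p.1 γ (U p) hp.1.1 hγ ?_ ?_ ?_
  · refine hmt.trans_eq ?_
    simp only [hV]
    ring
  · intro i; rw [← dHi i p hp]; exact (hmx i).1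
  · intro i; rw [← ddHi i]; exact (hmx i).2

lemma slice_fderiv {n : ℕ} {G : ℝ × EuclideanSpace ℝ (Fin n) → ℝ} {t : ℝ}
    {x : EuclideanSpace ℝ (Fin n)} (v : EuclideanSpace ℝ (Fin n))
    (h : DifferentiableAt ℝ G (t, x)) :
    fderiv ℝ (fun y => G (t, y)) x v = dd (0, v) G (t, x) := by
  have := h.hasFDerivAt.comp x (hasFDerivAt_prodMk_right t x)
  have h2 := this.fderiv
  have h3 : (G ∘ fun y => (t, y)) = fun y => G (t, y) := rfl
  rw [h3] at h2
  rw [h2]; simp [dd]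

lemma slice_deriv {n : ℕ} {G : ℝ × EuclideanSpace ℝ (Fin n) → ℝ} {t : ℝ}
    {x : EuclideanSpace ℝ (Fin n)}
    (h : DifferentiableAt ℝ G (t, x)) :
    deriv (fun s => G (s, x)) t = dd (1, 0) G (t, x) := by
  have := h.hasFDerivAt.comp t (hasFDerivAt_prodMk_left (𝕜 := ℝ) t x)
  have h2 := this.hasDerivAt.deriv
  have h3 : (G ∘ fun s => (s, x)) = fun s => G (s, x) := rfl
  rw [h3] at h2
  rw [h2]; simp [dd]

lemma log_pde (n : ℕ) (T γ : ℝ) (f : ℝ → EuclideanSpace ℝ (Fin n) → ℝ)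
    (hf : ContDiffOn ℝ (⊤ : ℕ∞) (Function.uncurry f)
      (Ioo (0 : ℝ) T ×ˢ (univ : Set (EuclideanSpace ℝ (Fin n)))))
    (hpos : ∀ t ∈ Ioo (0 : ℝ) T, ∀ x, 0 < f t x)
    (hpde : ∀ t ∈ Ioo (0 : ℝ) T, ∀ x,
      tderiv n f t x = slap n f t x - γ * f t x * Real.log (f t x))
    (U : ℝ × EuclideanSpace ℝ (Fin n) → ℝ) (hUdef : U = fun p => Real.log (f p.1 p.2))
    (hU : ContDiffOn ℝ (⊤ : ℕ∞) U (Ioo 0 T ×ˢ univ)) :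
    ∀ p ∈ Ioo 0 T ×ˢ (univ : Set (EuclideanSpace ℝ (Fin n))),
      dd (1, 0) U p = ∑ i, dd (0, e n i) (dd (0, e n i) U) p + ∑ i, (dd (0, e n i) U p) ^ 2
        + (-γ) * U p := by
  rintro ⟨t, x⟩ hp
  set O := Ioo 0 T ×ˢ (univ : Set (EuclideanSpace ℝ (Fin n))) with hOdef
  have hO : IsOpen O := isOpen_Ioo.prod isOpen_univ
  set F := Function.uncurry f with hF
  have hFpos : ∀ q ∈ O, 0 < F q := fun q hq => hpos q.1 hq.1 q.2
  have h1 : ∀ v, ∀ q ∈ O, dd v F q = F q * dd v U q := by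
    intro v q hq
    have hd := smooth_da hO hf hq
    have := (hd.hasFDerivAt.log (hFpos q hq).ne').fderiv
    have hUF : U = fun q => Real.log (F q) := by rw [hUdef]; rfl
    have hne := (hFpos q hq).ne'
    unfold dd
    rw [hUF, this]
    simp [hne]
  have h2 : ∀ v, ∀ q ∈ O, dd v (dd v F) q = F q * (dd v (dd v U) q + (dd v U q) ^ 2) := by
    intro v q hq
    rw [dd_congr hO v (h1 v) hq,
      dd_mul v (smooth_da hO hf hq) (smooth_da hO (dd_smooth hO v hU) hq), h1 v q hq]
    ring
  have ht : t ∈ Ioo 0 T := hp.1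
  have hmem : ∀ y, (t, y) ∈ O := fun y => ⟨ht, mem_univ _⟩
  have e1 : tderiv n f t x = dd (1, 0) F (t, x) := slice_deriv (smooth_da hO hf hp)
  have e2 : slap n f t x = ∑ i, dd (0, e n i) (dd (0, e n i) F) (t, x) := by
    unfold slap shess
    refine Finset.sum_congr rfl fun i _ => ?_
    have : (fun y => fderiv ℝ (f t) y (e n i)) = fun y => dd (0, e n i) F (t, y) := by
      funext y
      exact slice_fderiv (G := F) (e n i) (smooth_da hO hf (hmem y))
    rw [this]
    exact slice_fderiv _ (smooth_da hO (dd_smooth hO _ hf) hp)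
  have h := hpde t ht x
  rw [e1, e2, h1 _ _ hp] at h
  simp only [h2 _ _ hp] at h
  rw [← Finset.mul_sum, Finset.sum_add_distrib] at h
  have hUv : U (t, x) = Real.log (f t x) := by rw [hUdef]
  have hFv : F (t, x) = f t x := rfl
  rw [← hUv, ← hFv] at h
  have hne := (hFpos _ hp).ne'
  apply mul_left_cancel₀ hne
  rw [h]; ring

/-- Theorem C on the flat torus: gradient estimate for
`∂_t f = Δf − γ f log f` with `γ > 0` and `0 < f < 1`. -/
theorem gradient_estimate_nonlinear_heat_torus (n : ℕ) (hn : 1 ≤ n)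
    (T γ : ℝ) (hT : 0 < T) (hγ : 0 < γ)
    (f : ℝ → EuclideanSpace ℝ (Fin n) → ℝ)
    (hf : ContDiffOn ℝ (⊤ : ℕ∞) (Function.uncurry f)
      (Icc (0 : ℝ) T ×ˢ (univ : Set (EuclideanSpace ℝ (Fin n)))))
    (hpos : ∀ t ∈ Icc (0 : ℝ) T, ∀ x, 0 < f t x)
    (hlt : ∀ t ∈ Icc (0 : ℝ) T, ∀ x, f t x < 1)
    (hper : ∀ t ∈ Icc (0 : ℝ) T, ∀ x, ∀ k : Fin n → ℤ,
      f t (x + (WithLp.equiv 2 (Fin n → ℝ)).symm fun i => (k i : ℝ)) = f t x)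
    (hpde : ∀ t ∈ Icc (0 : ℝ) T, ∀ x,
      tderiv n f t x = slap n f t x - γ * f t x * Real.log (f t x)) :
    ∀ t ∈ Ioc (0 : ℝ) T, ∀ x,
      ‖sgrad n (fun s y => Real.log (f s y)) t x‖ ^ 2
        + Real.log (f t x) / t ≤ 0 := by
  set S := Icc (0 : ℝ) T ×ˢ (univ : Set (EuclideanSpace ℝ (Fin n))) with hS
  set U : ℝ × EuclideanSpace ℝ (Fin n) → ℝ := fun p => Real.log (f p.1 p.2) with hUdef
  have hUS : ContDiffOn ℝ (⊤ : ℕ∞) U S := hf.log fun p hp => (hpos p.1 hp.1 p.2).ne'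
  have hOS : Ioo (0 : ℝ) T ×ˢ (univ : Set (EuclideanSpace ℝ (Fin n))) ⊆ S :=
    prod_mono Ioo_subset_Icc_self le_rfl
  have hO : IsOpen (Ioo (0 : ℝ) T ×ˢ (univ : Set (EuclideanSpace ℝ (Fin n)))) :=
    isOpen_Ioo.prod isOpen_univ
  have hUO := hUS.mono hOS
  have hpdeU := log_pde n T γ f (hf.mono hOS) (fun t ht => hpos t (Ioo_subset_Icc_self ht))
    (fun t ht => hpde t (Ioo_subset_Icc_self ht)) U rfl hUO
  have hud : UniqueDiffOn ℝ S := (uniqueDiffOn_Icc hT).prod uniqueDiffOn_univ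
  -- the test function
  set K : ℝ × EuclideanSpace ℝ (Fin n) → ℝ :=
    fun p => p.1 * ∑ i, (fderivWithin ℝ U S p (0, e n i)) ^ 2 + U p with hK
  have hfw : ContinuousOn (fderivWithin ℝ U S) S :=
    hUS.continuousOn_fderivWithin hud (by simp)
  have hKc : ContinuousOn K S := by
    refine ContinuousOn.add (continuousOn_fst.mul ?_) hUS.continuousOn
    exact continuousOn_finsetSum _ fun i _ => (hfw.clm_apply continuousOn_const).pow 2
  have hslice : ∀ t ∈ Icc 0 T, ∀ x v, fderiv ℝ (fun y => Real.log (f t y)) x v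
      = fderivWithin ℝ U S (t, x) (0, v) := by
    intro t ht x v
    have hd : HasFDerivWithinAt U (fderivWithin ℝ U S (t, x)) S (t, x) :=
      (hUS.differentiableOn (by simp) _ ⟨ht, mem_univ _⟩).hasFDerivWithinAt
    have := hd.comp (s := univ) x (hasFDerivAt_prodMk_right t x).hasFDerivWithinAt
      (fun y _ => ⟨ht, mem_univ _⟩)
    have h2 := (hasFDerivWithinAt_univ.1 this).fderiv
    have h3 : (U ∘ fun y => (t, y)) = fun y => Real.log (f t y) := rfl
    rw [h3] at h2
    rw [h2]; simp
  have hKO : ∀ p ∈ Ioo (0 : ℝ) T ×ˢ (univ : Set (EuclideanSpace ℝ (Fin n))),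
      K p = p.1 * ∑ i, (dd (0, e n i) U p) ^ 2 + U p := by
    intro p hp
    have : S ∈ nhds p := Filter.mem_of_superset (hO.mem_nhds hp) hOS
    simp only [hK, dd, fderivWithin_of_mem_nhds this]
  have hKper : ∀ t ∈ Icc 0 T, ∀ x, ∀ k : Fin n → ℤ,
      K (t, x + (WithLp.equiv 2 (Fin n → ℝ)).symm fun i => (k i : ℝ)) = K (t, x) := by
    intro t ht x k
    have h1 : ∀ v, fderiv ℝ (fun y => Real.log (f t y))
        (x + (WithLp.equiv 2 (Fin n → ℝ)).symm fun i => (k i : ℝ)) v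
        = fderiv ℝ (fun y => Real.log (f t y)) x v := by
      intro v
      rw [← fderiv_comp_add_right]
      simp only [hper t ht _ k]
    have h2 : ∀ y, K (t, y) = t * ∑ i, (fderiv ℝ (fun y => Real.log (f t y)) y (e n i)) ^ 2
        + Real.log (f t y) := fun y => by simp only [hslice t ht]; rfl
    simp only [h2, h1, hper t ht x k]
  -- reduction to a fundamental domain
  set C : Set (EuclideanSpace ℝ (Fin n)) :=
    (fun w => (WithLp.toLp 2 w : EuclideanSpace ℝ (Fin n))) ''
      (Set.pi univ fun _ => Icc (0 : ℝ) 1) with hC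
  have hCc : IsCompact C :=
    (isCompact_univ_pi fun _ => isCompact_Icc).image (PiLp.continuous_toLp 2 _)
  have hred : ∀ x : EuclideanSpace ℝ (Fin n), ∃ y ∈ C, ∀ t ∈ Icc 0 T, K (t, x) = K (t, y) := by
    intro x
    refine ⟨WithLp.toLp 2 fun i => Int.fract (x i), ⟨_, fun i _ =>
      ⟨Int.fract_nonneg _, (Int.fract_lt_one _).le⟩, rfl⟩, fun t ht => ?_⟩
    rw [← hKper t ht (WithLp.toLp 2 fun i => Int.fract (x i)) fun i => ⌊x i⌋]
    congr 2
    ext i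
    simp [Int.fract_add_floor]
  have main : ∀ t ∈ Ioo 0 T, ∀ x, K (t, x) ≤ 0 := by
    intro t ht x
    by_contra! hcon
    have htT : Icc 0 t ⊆ Icc 0 T := Icc_subset_Icc_right ht.2.le
    obtain ⟨y, hyC, hy⟩ := hred x
    obtain ⟨p, hp, hmax⟩ := (isCompact_Icc (a := (0 : ℝ)) (b := t)).prod hCc |>.exists_isMaxOn
      ⟨(t, y), ⟨right_mem_Icc.2 ht.1.le, hyC⟩⟩
      (hKc.mono (prod_mono htT (subset_univ _)))
    have hglob : ∀ q : ℝ × EuclideanSpace ℝ (Fin n), q.1 ∈ Icc 0 t → K q ≤ K p := by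
      rintro ⟨s, z⟩ hs
      obtain ⟨z', hz'C, hz'⟩ := hred z
      rw [hz' s (htT hs)]
      exact hmax ⟨hs, hz'C⟩
    have hKp : 0 < K p := hcon.trans_le (hglob (t, x) (right_mem_Icc.2 ht.1.le))
    have hp0 : p.1 ≠ 0 := by
      intro h0
      have : K p = U p := by simp [hK, h0]
      have hneg : U p < 0 :=
        Real.log_neg (hpos p.1 (htT hp.1) p.2) (hlt p.1 (htT hp.1) p.2)
      linarith
    have hpO : p ∈ Ioo (0 : ℝ) T ×ˢ (univ : Set (EuclideanSpace ℝ (Fin n))) :=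
      ⟨⟨lt_of_le_of_ne hp.1.1 hp0.symm, hp.1.2.trans_lt ht.2⟩, mem_univ _⟩
    have := key_max n T γ hγ U hUO hpdeU p hpO (by
      intro q hq hqp
      rw [← hKO q hq, ← hKO p hpO]
      exact hglob q ⟨hq.1.1.le, hqp.trans hp.1.2⟩)
    rw [← hKO p hpO] at this
    linarith
  intro t ht x
  have htI : t ∈ Icc 0 T := Ioc_subset_Icc_self ht
  have hKt : K (t, x) ≤ 0 := by
    have hcl : closure (Ioo 0 T) = Icc 0 T := closure_Ioo hT.ne
    refine le_on_closure (f := fun s => K (s, x)) (g := fun _ => 0) (fun s hs => main s hs x) ?_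
      continuousOn_const (x := t) (by rw [hcl]; exact htI)
    rw [hcl]
    exact hKc.comp (by fun_prop) fun s hs => ⟨hs, mem_univ _⟩
  have hnorm : ‖sgrad n (fun s y => Real.log (f s y)) t x‖ ^ 2
      = ∑ i, (fderivWithin ℝ U S (t, x) (0, e n i)) ^ 2 := by
    rw [EuclideanSpace.real_norm_sq_eq]
    refine Finset.sum_congr rfl fun i _ => ?_
    have h : inner ℝ (gradient (fun y => Real.log (f t y)) x) (EuclideanSpace.single i (1 : ℝ))
      = fderiv ℝ (fun y => Real.log (f t y)) x (EuclideanSpace.single i 1) := inner_gradient_left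
    rw [← hslice t htI, sgrad, e, ← h, EuclideanSpace.inner_single_right]
    simp
  rw [hnorm]
  have ht0 : 0 < t := ht.1
  have hK' : t * ∑ i, (fderivWithin ℝ U S (t, x) (0, e n i)) ^ 2 + Real.log (f t x) ≤ 0 := hKt
  have : ∑ i, (fderivWithin ℝ U S (t, x) (0, e n i)) ^ 2 + Real.log (f t x) / t
      = (t * ∑ i, (fderivWithin ℝ U S (t, x) (0, e n i)) ^ 2 + Real.log (f t x)) / t := by
    field_simp
  rw [this]
  exact div_nonpos_of_nonpos_of_nonneg hK' ht0.le
end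
end
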